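/- (Uniform stabilization, case (ii).) Let (T, q) be a classical solution of the Guyer–Krumhansl system on (0,l) with boundary conditions q(0,t) = q(l,t) = 0, and suppose the initial datum has zero mean: ∫_0^l T(x,0) dx = 0. With β := min(2k/(ρc), 4(l² + μ²)/τ_q), ω := β/(3l² + 3μ² + 2τ_q k/(ρc)) and M₀ := (3l² + 3μ² + 2τ_q k/(ρc))/(l² + μ²), the functional energy decays exponentially: E(t) ≤ M₀ E(0) e^{−ωt} for all t ≥ 0. -/

import Mathlib

open Set MeasureTheory intervalIntegral

/-- A classical solution of the one-dimensional Guyer–Krumhansl system on `(0, l)`: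
`T` is the temperature, `q` the heat flux, and `Tt, Tx, qt, qx, qxx` are the
corresponding partial derivatives (continuous on `[0,l] × [0,∞)`), satisfying
`ρ c T_t + q_x = 0` and `τ_q q_t + q − μ² q_xx + k T_x = 0` on `(0,l) × (0,∞)`,
with adiabatic boundary conditions `q(0,t) = q(l,t) = 0` for all `t ≥ 0`. -/
structure IsGKSolution (l ρ c τq μ2 k : ℝ)
    (T q Tt Tx qt qx qxx : ℝ → ℝ → ℝ) : Prop where
  contT : ContinuousOn (fun p : ℝ × ℝ => T p.1 p.2) (Icc (0:ℝ) l ×ˢ Ici (0:ℝ))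
  contq : ContinuousOn (fun p : ℝ × ℝ => q p.1 p.2) (Icc (0:ℝ) l ×ˢ Ici (0:ℝ))
  hTt : ∀ x ∈ Icc (0:ℝ) l, ∀ t ∈ Ici (0:ℝ),
    HasDerivWithinAt (fun s => T x s) (Tt x t) (Ici (0:ℝ)) t
  hTx : ∀ x ∈ Icc (0:ℝ) l, ∀ t ∈ Ici (0:ℝ),
    HasDerivWithinAt (fun y => T y t) (Tx x t) (Icc (0:ℝ) l) x
  hqt : ∀ x ∈ Icc (0:ℝ) l, ∀ t ∈ Ici (0:ℝ),
    HasDerivWithinAt (fun s => q x s) (qt x t) (Ici (0:ℝ)) t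
  hqx : ∀ x ∈ Icc (0:ℝ) l, ∀ t ∈ Ici (0:ℝ),
    HasDerivWithinAt (fun y => q y t) (qx x t) (Icc (0:ℝ) l) x
  hqxx : ∀ x ∈ Icc (0:ℝ) l, ∀ t ∈ Ici (0:ℝ),
    HasDerivWithinAt (fun y => qx y t) (qxx x t) (Icc (0:ℝ) l) x
  contTt : ContinuousOn (fun p : ℝ × ℝ => Tt p.1 p.2) (Icc (0:ℝ) l ×ˢ Ici (0:ℝ))
  contTx : ContinuousOn (fun p : ℝ × ℝ => Tx p.1 p.2) (Icc (0:ℝ) l ×ˢ Ici (0:ℝ))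
  contqt : ContinuousOn (fun p : ℝ × ℝ => qt p.1 p.2) (Icc (0:ℝ) l ×ˢ Ici (0:ℝ))
  contqx : ContinuousOn (fun p : ℝ × ℝ => qx p.1 p.2) (Icc (0:ℝ) l ×ˢ Ici (0:ℝ))
  contqxx : ContinuousOn (fun p : ℝ × ℝ => qxx p.1 p.2) (Icc (0:ℝ) l ×ˢ Ici (0:ℝ))
  pde1 : ∀ x ∈ Ioo (0:ℝ) l, ∀ t ∈ Ioi (0:ℝ), ρ * c * Tt x t + qx x t = 0
  pde2 : ∀ x ∈ Ioo (0:ℝ) l, ∀ t ∈ Ioi (0:ℝ),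
    τq * qt x t + q x t - μ2 * qxx x t + k * Tx x t = 0
  bc0 : ∀ t : ℝ, 0 ≤ t → q 0 t = 0
  bcl : ∀ t : ℝ, 0 ≤ t → q l t = 0

/-- The functional energy `E(t) = (ρc/2)∫₀ˡ T² dx + (τ_q/(2k))∫₀ˡ q² dx`. -/
noncomputable def gkEnergy (l ρ c τq k : ℝ) (T q : ℝ → ℝ → ℝ) (t : ℝ) : ℝ :=
  ρ * c / 2 * (∫ x in (0:ℝ)..l, (T x t) ^ 2)
    + τq / (2 * k) * (∫ x in (0:ℝ)..l, (q x t) ^ 2)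


lemma gk_slice {l : ℝ} {f : ℝ → ℝ → ℝ}
    (hf : ContinuousOn (fun p : ℝ × ℝ => f p.1 p.2) (Icc (0:ℝ) l ×ˢ Ici (0:ℝ)))
    {t : ℝ} (ht : 0 ≤ t) : ContinuousOn (fun y => f y t) (Icc (0:ℝ) l) := by
  have : ContinuousOn (fun y : ℝ => ((y, t) : ℝ × ℝ)) (Icc (0:ℝ) l) := by fun_prop
  exact hf.comp this (fun y hy => ⟨hy, ht⟩)

lemma gk_int {l : ℝ} {g : ℝ → ℝ} (hg : ContinuousOn g (Icc (0:ℝ) l))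
    {x : ℝ} (hx : x ∈ Icc (0:ℝ) l) : IntervalIntegrable g volume 0 x := by
  apply ContinuousOn.intervalIntegrable
  rw [uIcc_of_le hx.1]
  exact hg.mono (Icc_subset_Icc le_rfl hx.2)

lemma gk_primitive_cont {l : ℝ} (hl : 0 < l) {f : ℝ → ℝ → ℝ}
    (hf : ContinuousOn (fun p : ℝ × ℝ => f p.1 p.2) (Icc (0:ℝ) l ×ˢ Ici (0:ℝ))) :
    ContinuousOn (fun p : ℝ × ℝ => ∫ y in (0:ℝ)..p.1, f y p.2) (Icc (0:ℝ) l ×ˢ Ici (0:ℝ)) := by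
  let F : ℝ × ℝ → ℝ → ℝ := fun p y => f (max 0 (min y l)) (max p.2 0)
  have hF : Continuous (Function.uncurry F) := by
    have h1 : Continuous (fun z : (ℝ × ℝ) × ℝ => ((max 0 (min z.2 l), max z.1.2 0) : ℝ × ℝ)) := by
      fun_prop
    exact hf.comp_continuous h1 (fun z =>
      ⟨⟨le_max_left _ _, max_le hl.le (min_le_right _ _)⟩, mem_Ici.mpr (le_max_right _ _)⟩)
  have h2 : Continuous (fun p : ℝ × ℝ => ∫ y in (0:ℝ)..p.1, F p y) :=
    intervalIntegral.continuous_parametric_intervalIntegral_of_continuous hF continuous_fst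
  refine h2.continuousOn.congr ?_
  rintro ⟨x, t⟩ ⟨hx, ht⟩
  simp only [mem_Icc, mem_Ici] at hx ht
  apply intervalIntegral.integral_congr
  intro y hy
  rw [uIcc_of_le hx.1] at hy
  simp only [F]
  rw [max_eq_left ht, min_eq_left (hy.2.trans hx.2), max_eq_right hy.1]

lemma gk_int_cont {l : ℝ} (hl : 0 < l) {f : ℝ → ℝ → ℝ}
    (hf : ContinuousOn (fun p : ℝ × ℝ => f p.1 p.2) (Icc (0:ℝ) l ×ˢ Ici (0:ℝ)))
    {x : ℝ} (hx : x ∈ Icc (0:ℝ) l) :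
    ContinuousOn (fun t => ∫ y in (0:ℝ)..x, f y t) (Ici (0:ℝ)) := by
  have : ContinuousOn (fun t : ℝ => ((x, t) : ℝ × ℝ)) (Ici (0:ℝ)) := by fun_prop
  exact (gk_primitive_cont hl hf).comp this (fun y hy => ⟨hx, hy⟩)

lemma gk_deriv_int {l : ℝ} {f ft : ℝ → ℝ → ℝ}
    (hf : ContinuousOn (fun p : ℝ × ℝ => f p.1 p.2) (Icc (0:ℝ) l ×ˢ Ici (0:ℝ)))
    (hft : ContinuousOn (fun p : ℝ × ℝ => ft p.1 p.2) (Icc (0:ℝ) l ×ˢ Ici (0:ℝ)))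
    (hd : ∀ x ∈ Icc (0:ℝ) l, ∀ t, 0 < t → HasDerivAt (fun s => f x s) (ft x t) t)
    {x : ℝ} (hx : x ∈ Icc (0:ℝ) l) {t : ℝ} (ht : 0 < t) :
    HasDerivAt (fun s => ∫ y in (0:ℝ)..x, f y s) (∫ y in (0:ℝ)..x, ft y t) t := by
  have hK : IsCompact (Icc (0:ℝ) l ×ˢ Icc (t/2) (2*t)) := isCompact_Icc.prod isCompact_Icc
  obtain ⟨C, hC⟩ := hK.exists_bound_of_continuousOn
    (hft.mono (prod_mono le_rfl (fun s hs => by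
      have := hs.1
      simp only [mem_Ici]; linarith)))
  have hsub : ∀ y ∈ uIoc (0:ℝ) x, y ∈ Icc (0:ℝ) l := by
    intro y hy
    rw [uIoc_of_le hx.1] at hy
    exact ⟨hy.1.le, hy.2.trans hx.2⟩
  have key := intervalIntegral.hasDerivAt_integral_of_dominated_loc_of_deriv_le
    (μ := volume) (F := fun s y => f y s) (F' := fun s y => ft y s) (x₀ := t) (a := 0) (b := x)
    (s := Icc (t/2) (2*t)) (bound := fun _ => C)
    (Icc_mem_nhds (by linarith) (by linarith))
    (by
      filter_upwards [lt_mem_nhds ht] with s hs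
      exact (intervalIntegrable_iff.mp (gk_int (gk_slice hf hs.le) hx)).aestronglyMeasurable)
    (gk_int (gk_slice hf ht.le) hx)
    ((intervalIntegrable_iff.mp (gk_int (gk_slice hft ht.le) hx)).aestronglyMeasurable)
    (by
      refine Filter.Eventually.of_forall (fun y hy s hs => ?_)
      exact hC (y, s) ⟨hsub y hy, hs⟩)
    (intervalIntegrable_const)
    (by
      refine Filter.Eventually.of_forall (fun y hy s hs => ?_)
      exact hd y (hsub y hy) s (by have := hs.1; linarith))
  exact key.2

lemma gk_poincare {l : ℝ} (hl : 0 < l) {g : ℝ → ℝ} (hg : ContinuousOn g (Icc (0:ℝ) l))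
    (hW : ContinuousOn (fun x => ∫ y in (0:ℝ)..x, g y) (Icc (0:ℝ) l)) :
    ∫ x in (0:ℝ)..l, (∫ y in (0:ℝ)..x, g y) ^ 2 ≤ l ^ 2 / 2 * ∫ x in (0:ℝ)..l, g x ^ 2 := by
  have hll : l ∈ Icc (0:ℝ) l := ⟨hl.le, le_rfl⟩
  have hg2 : ContinuousOn (fun x => g x ^ 2) (Icc (0:ℝ) l) := hg.pow 2
  have h1 : ∀ x ∈ Icc (0:ℝ) l, (∫ y in (0:ℝ)..x, g y) ^ 2 ≤ x * ∫ y in (0:ℝ)..l, g y ^ 2 := by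
    intro x hx
    rcases hx.1.eq_or_lt with h0 | h0
    · subst h0; simp
    set w := ∫ y in (0:ℝ)..x, g y with hw
    have hA : ∫ y in (0:ℝ)..x, g y ^ 2 ≤ ∫ y in (0:ℝ)..l, g y ^ 2 := by
      apply intervalIntegral.integral_mono_interval le_rfl hx.1 hx.2
      · exact Filter.Eventually.of_forall (fun y => sq_nonneg _)
      · exact gk_int hg2 hll
    have hB : 0 ≤ ∫ y in (0:ℝ)..x, (x * g y - w) ^ 2 :=
      intervalIntegral.integral_nonneg hx.1 (fun y _ => sq_nonneg _)
    have hC : ∫ y in (0:ℝ)..x, (x * g y - w) ^ 2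
        = x ^ 2 * (∫ y in (0:ℝ)..x, g y ^ 2) - 2 * x * w * w + x * w ^ 2 := by
      have e : (fun y => (x * g y - w) ^ 2)
          = fun y => (x ^ 2 * g y ^ 2 - 2 * x * w * g y) + w ^ 2 := by
        funext y; ring
      rw [e, intervalIntegral.integral_add, intervalIntegral.integral_sub,
        intervalIntegral.integral_const_mul, intervalIntegral.integral_const_mul, ← hw]
      · simp
      · exact (gk_int hg2 hx).const_mul _
      · exact (gk_int hg hx).const_mul _
      · exact ((gk_int hg2 hx).const_mul _).sub ((gk_int hg hx).const_mul _)
      · exact intervalIntegrable_const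
    rw [hC] at hB
    have hD : 0 ≤ x * (x * (∫ y in (0:ℝ)..x, g y ^ 2) - w ^ 2) := by nlinarith
    have hE := nonneg_of_mul_nonneg_right hD h0
    nlinarith
  calc _ ≤ ∫ x in (0:ℝ)..l, x * ∫ y in (0:ℝ)..l, g y ^ 2 := by
        apply intervalIntegral.integral_mono_on hl.le (gk_int (hW.pow 2) hll)
        · exact gk_int (by fun_prop) hll
        · exact h1
    _ = _ := by
        rw [intervalIntegral.integral_mul_const, integral_id]; ring

/-- uniform stabilization, case (ii): if the initial datum has zero
mean, `∫₀ˡ T(x,0) dx = 0`, then with `β = min(2k/(ρc), 4(l²+μ²)/τ_q)`,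
`ω = β/(3l²+3μ²+2τ_q k/(ρc))` and `M₀ = (3l²+3μ²+2τ_q k/(ρc))/(l²+μ²)`, the energy
decays exponentially: `E(t) ≤ M₀ E(0) e^{−ωt}` for all `t ≥ 0`. -/
theorem gk_uniform_stabilization_case_ii
    (l ρ c τq μ2 k : ℝ) (hl : 0 < l) (hρ : 0 < ρ) (hc : 0 < c)
    (hτq : 0 < τq) (hμ2 : 0 < μ2) (hk : 0 < k)
    (T q Tt Tx qt qx qxx : ℝ → ℝ → ℝ)
    (hgk : IsGKSolution l ρ c τq μ2 k T q Tt Tx qt qx qxx)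
    (hmean : (∫ x in (0:ℝ)..l, T x 0) = 0)
    (β ω M₀ : ℝ)
    (hβ : β = min (2 * k / (ρ * c)) (4 * (l ^ 2 + μ2) / τq))
    (hω : ω = β / (3 * l ^ 2 + 3 * μ2 + 2 * (τq * k / (ρ * c))))
    (hM₀ : M₀ = (3 * l ^ 2 + 3 * μ2 + 2 * (τq * k / (ρ * c))) / (l ^ 2 + μ2)) :
    ∀ t : ℝ, 0 ≤ t →
      gkEnergy l ρ c τq k T q t
        ≤ M₀ * gkEnergy l ρ c τq k T q 0 * Real.exp (-ω * t) := by
  have hll : l ∈ Icc (0:ℝ) l := ⟨hl.le, le_rfl⟩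
  have ha : 0 < ρ * c := mul_pos hρ hc
  obtain ⟨cT, cq, hTt, hTx, hqt, hqx, hqxx, cTt, cTx, cqt, cqx, cqxx, pde1, pde2, bc0, bcl⟩ := hgk
  unfold gkEnergy
  generalize ρ * c = a at *
  -- the primitive of the temperature
  obtain ⟨W, hWdef⟩ : ∃ W : ℝ → ℝ → ℝ, W = fun x t => ∫ y in (0:ℝ)..x, T y t := ⟨_, rfl⟩
  have cW : ContinuousOn (fun p : ℝ × ℝ => W p.1 p.2) (Icc (0:ℝ) l ×ˢ Ici (0:ℝ)) := by
    rw [hWdef]; exact gk_primitive_cont hl cT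
  have hTt' : ∀ x ∈ Icc (0:ℝ) l, ∀ t, 0 < t → HasDerivAt (fun s => T x s) (Tt x t) t :=
    fun x hx t ht => (hTt x hx t ht.le).hasDerivAt (Ici_mem_nhds ht)
  have hqt' : ∀ x ∈ Icc (0:ℝ) l, ∀ t, 0 < t → HasDerivAt (fun s => q x s) (qt x t) t :=
    fun x hx t ht => (hqt x hx t ht.le).hasDerivAt (Ici_mem_nhds ht)
  have hTx' : ∀ x ∈ Ioo (0:ℝ) l, ∀ t, 0 < t → HasDerivAt (fun y => T y t) (Tx x t) x :=
    fun x hx t ht => (hTx x (Ioo_subset_Icc_self hx) t ht.le).hasDerivAt (Icc_mem_nhds hx.1 hx.2)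
  have hqx' : ∀ x ∈ Ioo (0:ℝ) l, ∀ t, 0 < t → HasDerivAt (fun y => q y t) (qx x t) x :=
    fun x hx t ht => (hqx x (Ioo_subset_Icc_self hx) t ht.le).hasDerivAt (Icc_mem_nhds hx.1 hx.2)
  have hqxx' : ∀ x ∈ Ioo (0:ℝ) l, ∀ t, 0 < t → HasDerivAt (fun y => qx y t) (qxx x t) x :=
    fun x hx t ht => (hqxx x (Ioo_subset_Icc_self hx) t ht.le).hasDerivAt (Icc_mem_nhds hx.1 hx.2)
  have hWx : ∀ x ∈ Ioo (0:ℝ) l, ∀ t, 0 < t → HasDerivAt (fun y => W y t) (T x t) x := by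
    intro x hx t ht
    rw [hWdef]
    have hs := gk_slice cT ht.le
    exact intervalIntegral.integral_hasDerivAt_right (gk_int hs (Ioo_subset_Icc_self hx))
      ((hs.mono Ioo_subset_Icc_self).stronglyMeasurableAtFilter isOpen_Ioo x hx)
      (hs.continuousAt (Icc_mem_nhds hx.1 hx.2))
  have hWt : ∀ x ∈ Icc (0:ℝ) l, ∀ t, 0 < t → HasDerivAt (fun s => W x s) (-(q x t) / a) t := by
    intro x hx t ht
    have h1 := gk_deriv_int cT cTt hTt' hx ht
    have h2 : ∫ y in (0:ℝ)..x, qx y t = q x t := by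
      rw [intervalIntegral.integral_eq_sub_of_hasDerivAt_of_le hx.1
        ((gk_slice cq ht.le).mono (Icc_subset_Icc le_rfl hx.2))
        (fun y hy => hqx' y ⟨hy.1, hy.2.trans_le hx.2⟩ t ht) (gk_int (gk_slice cqx ht.le) hx),
        bc0 t ht.le, sub_zero]
    have h3 : ∫ y in (0:ℝ)..x, Tt y t = -(q x t) / a := by
      rw [← h2]
      have h4 : ∫ y in (0:ℝ)..x, Tt y t = ∫ y in (0:ℝ)..x, (-1 / a) * qx y t := by
        rw [intervalIntegral.integral_of_le hx.1, intervalIntegral.integral_of_le hx.1,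
          integral_Ioc_eq_integral_Ioo, integral_Ioc_eq_integral_Ioo]
        apply setIntegral_congr_fun measurableSet_Ioo
        intro y hy
        have := pde1 y ⟨hy.1, hy.2.trans_le hx.2⟩ t ht
        simp only
        field_simp
        linarith
      rw [h4, intervalIntegral.integral_const_mul]
      ring
    rw [hWdef, ← h3]
    exact h1
  have hW0 : ∀ t, W 0 t = 0 := by intro t; simp [hWdef]
  have hWl : ∀ t, 0 ≤ t → W l t = 0 := by
    have hWl0 : W l 0 = 0 := by rw [hWdef]; exact hmean
    have hcont : ContinuousOn (fun t => W l t) (Ici 0) := by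
      rw [hWdef]; exact gk_int_cont hl cT hll
    have hder : ∀ t ∈ interior (Ici (0:ℝ)), HasDerivAt (fun s => W l s) 0 t := by
      intro t ht
      rw [interior_Ici] at ht
      have := hWt l hll t ht
      rwa [bcl t (le_of_lt ht), neg_zero, zero_div] at this
    have hA := antitoneOn_of_deriv_nonpos (convex_Ici 0) hcont
      (fun t ht => (hder t ht).differentiableAt.differentiableWithinAt)
      (fun t ht => (hder t ht).deriv.le)
    have hM := monotoneOn_of_deriv_nonneg (convex_Ici 0) hcont
      (fun t ht => (hder t ht).differentiableAt.differentiableWithinAt)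
      (fun t ht => (hder t ht).deriv.ge)
    intro t ht
    have h1 := hA (mem_Ici.mpr le_rfl) (mem_Ici.mpr ht) ht
    have h2 := hM (mem_Ici.mpr le_rfl) (mem_Ici.mpr ht) ht
    simp only [hWl0] at h1 h2
    linarith
  -- Lyapunov density
  obtain ⟨N, hN⟩ : ∃ N, N = 2 * (l ^ 2 + μ2) + τq * k / a := ⟨_, rfl⟩
  obtain ⟨e, he⟩ : ∃ e : ℝ → ℝ → ℝ, e = fun x t =>
    -τq * (q x t * W x t) + a / 2 * W x t ^ 2 + (a * μ2 / 2 + N * a / 2) * T x t ^ 2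
      + N * τq / (2 * k) * q x t ^ 2 := ⟨_, rfl⟩
  obtain ⟨et, het⟩ : ∃ et : ℝ → ℝ → ℝ, et = fun x t =>
    -τq * (qt x t * W x t + q x t * (-(q x t) / a)) + a / 2 * (2 * W x t * (-(q x t) / a))
      + (a * μ2 / 2 + N * a / 2) * (2 * T x t * Tt x t)
      + N * τq / (2 * k) * (2 * q x t * qt x t) := ⟨_, rfl⟩
  have ce : ContinuousOn (fun p : ℝ × ℝ => e p.1 p.2) (Icc (0:ℝ) l ×ˢ Ici (0:ℝ)) := by
    rw [he]; fun_prop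
  have cet : ContinuousOn (fun p : ℝ × ℝ => et p.1 p.2) (Icc (0:ℝ) l ×ˢ Ici (0:ℝ)) := by
    rw [het]; fun_prop
  have hed : ∀ x ∈ Icc (0:ℝ) l, ∀ t, 0 < t → HasDerivAt (fun s => e x s) (et x t) t := by
    intro x hx t ht
    have dW := hWt x hx t ht
    have dq := hqt' x hx t ht
    have dT := hTt' x hx t ht
    rw [he, het]
    have := (((dq.mul dW).const_mul (-τq)).add ((dW.pow 2).const_mul (a / 2))).add
      ((dT.pow 2).const_mul (a * μ2 / 2 + N * a / 2)) |>.add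
      ((dq.pow 2).const_mul (N * τq / (2 * k)))
    refine HasDerivAt.congr_deriv (f := fun s => _) this ?_
    simp
  obtain ⟨L, hL⟩ : ∃ L : ℝ → ℝ, L = fun t => ∫ x in (0:ℝ)..l, e x t := ⟨_, rfl⟩
  have hLc : ContinuousOn L (Ici 0) := by rw [hL]; exact gk_int_cont hl ce hll
  have hLd : ∀ t, 0 < t → HasDerivAt L (∫ x in (0:ℝ)..l, et x t) t := by
    intro t ht; rw [hL]; exact gk_deriv_int ce cet hed hll ht
  have hNpos : 0 < N := by rw [hN]; positivity
  obtain ⟨E, hE⟩ : ∃ E : ℝ → ℝ, E = fun t => a / 2 * (∫ x in (0:ℝ)..l, (T x t) ^ 2)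
    + τq / (2 * k) * (∫ x in (0:ℝ)..l, (q x t) ^ 2) := ⟨_, rfl⟩
  have iT2 : ∀ t, 0 ≤ t → IntervalIntegrable (fun x => T x t ^ 2) volume 0 l :=
    fun t ht => gk_int ((gk_slice cT ht).pow 2) hll
  have iq2 : ∀ t, 0 ≤ t → IntervalIntegrable (fun x => q x t ^ 2) volume 0 l :=
    fun t ht => gk_int ((gk_slice cq ht).pow 2) hll
  have iW2 : ∀ t, 0 ≤ t → IntervalIntegrable (fun x => W x t ^ 2) volume 0 l :=
    fun t ht => gk_int ((gk_slice cW ht).pow 2) hll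
  have hcomb : ∀ (A B : ℝ) t, 0 ≤ t → ∫ x in (0:ℝ)..l, (A * T x t ^ 2 + B * q x t ^ 2)
      = A * (∫ x in (0:ℝ)..l, T x t ^ 2) + B * ∫ x in (0:ℝ)..l, q x t ^ 2 := by
    intro A B t ht
    rw [intervalIntegral.integral_add ((iT2 t ht).const_mul A) ((iq2 t ht).const_mul B),
      intervalIntegral.integral_const_mul, intervalIntegral.integral_const_mul]
  have nT : ∀ t, 0 ≤ ∫ x in (0:ℝ)..l, T x t ^ 2 :=
    fun t => intervalIntegral.integral_nonneg hl.le (fun _ _ => sq_nonneg _)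
  have nq : ∀ t, 0 ≤ ∫ x in (0:ℝ)..l, q x t ^ 2 :=
    fun t => intervalIntegral.integral_nonneg hl.le (fun _ _ => sq_nonneg _)
  have hEnn : ∀ t, 0 ≤ E t := by
    intro t; rw [hE]; have := nT t; have := nq t; positivity
  have young : ∀ u w : ℝ, |τq * (u * w)| ≤ τq ^ 2 / (2 * a) * u ^ 2 + a / 2 * w ^ 2 := by
    intro u w
    have h1 : τq ^ 2 / (2 * a) * u ^ 2 + a / 2 * w ^ 2 - τq * (u * w)
        = (τq * u - a * w) ^ 2 / (2 * a) := by field_simp; ring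
    have h2 : τq ^ 2 / (2 * a) * u ^ 2 + a / 2 * w ^ 2 + τq * (u * w)
        = (τq * u + a * w) ^ 2 / (2 * a) := by field_simp; ring
    have h3 : 0 ≤ (τq * u - a * w) ^ 2 / (2 * a) := by positivity
    have h4 : 0 ≤ (τq * u + a * w) ^ 2 / (2 * a) := by positivity
    rw [abs_le]; constructor <;> linarith
  have hNq : N * τq / (2 * k) = (l ^ 2 + μ2) * τq / k + τq ^ 2 / (2 * a) := by
    rw [hN]; field_simp
  -- lower bound
  have hlow : ∀ t, 0 ≤ t → (l ^ 2 + μ2) * E t ≤ L t := by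
    intro t ht
    have h1 : ∫ x in (0:ℝ)..l, ((l ^ 2 + μ2) * (a / 2) * T x t ^ 2
        + (l ^ 2 + μ2) * (τq / (2 * k)) * q x t ^ 2) ≤ L t := by
      rw [hL]
      apply intervalIntegral.integral_mono_on hl.le
        (((iT2 t ht).const_mul _).add ((iq2 t ht).const_mul _)) (gk_int (gk_slice ce ht) hll)
      intro x hx
      rw [he]
      simp only
      have h2 := (abs_le.mp (young (q x t) (W x t))).2
      rw [hNq]
      have h3 : (l ^ 2 + μ2) * (τq / (2 * k)) * q x t ^ 2
        ≤ (l ^ 2 + μ2) * τq / k * q x t ^ 2 := by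
        have : (l ^ 2 + μ2) * τq / k = 2 * ((l ^ 2 + μ2) * (τq / (2 * k))) := by field_simp
        rw [this]
        have : 0 ≤ (l ^ 2 + μ2) * (τq / (2 * k)) * q x t ^ 2 := by positivity
        linarith
      have h4 : (l ^ 2 + μ2) * (a / 2) * T x t ^ 2
          ≤ (a * μ2 / 2 + N * a / 2) * T x t ^ 2 := by
        apply mul_le_mul_of_nonneg_right _ (sq_nonneg _)
        have h5 : l ^ 2 + μ2 ≤ N := by
          rw [hN]
          have : 0 < τq * k / a := by positivity
          nlinarith [sq_nonneg l]
        nlinarith [mul_pos ha hμ2, mul_le_mul_of_nonneg_left h5 ha.le]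
      linarith
    rw [hcomb _ _ t ht] at h1
    rw [hE]
    linarith
  obtain ⟨D, hD⟩ : ∃ D, D = 3 * l ^ 2 + 3 * μ2 + 2 * (τq * k / a) := ⟨_, rfl⟩
  rw [← hD] at hω hM₀
  have hDpos : 0 < D := by rw [hD]; positivity
  -- upper bound
  have hup : ∀ t, 0 ≤ t → L t ≤ D * E t := by
    intro t ht
    have hP : ∫ x in (0:ℝ)..l, W x t ^ 2 ≤ l ^ 2 / 2 * ∫ x in (0:ℝ)..l, T x t ^ 2 := by
      have := gk_slice cW ht
      rw [hWdef] at this ⊢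
      exact gk_poincare hl (gk_slice cT ht) this
    have h1 : L t ≤ ∫ x in (0:ℝ)..l, (((a * μ2 / 2 + N * a / 2) * T x t ^ 2
        + (N * τq / (2 * k) + τq ^ 2 / (2 * a)) * q x t ^ 2) + a * W x t ^ 2) := by
      rw [hL]
      apply intervalIntegral.integral_mono_on hl.le (gk_int (gk_slice ce ht) hll)
        ((((iT2 t ht).const_mul _).add ((iq2 t ht).const_mul _)).add ((iW2 t ht).const_mul _))
      intro x hx
      rw [he]
      simp only
      have h2 := (abs_le.mp (young (q x t) (W x t))).1
      linarith
    rw [intervalIntegral.integral_add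
      (((iT2 t ht).const_mul _).add ((iq2 t ht).const_mul _)) ((iW2 t ht).const_mul _),
      hcomb _ _ t ht, intervalIntegral.integral_const_mul] at h1
    have h2 : N * τq / (2 * k) + τq ^ 2 / (2 * a) ≤ D * (τq / (2 * k)) := by
      have : D * (τq / (2 * k)) - (N * τq / (2 * k) + τq ^ 2 / (2 * a))
          = (l ^ 2 + μ2) * (τq / (2 * k)) := by
        rw [hD, hN]; field_simp; ring
      have : 0 ≤ (l ^ 2 + μ2) * (τq / (2 * k)) := by positivity
      linarith
    have h3 : (a * μ2 / 2 + N * a / 2) + a * (l ^ 2 / 2) ≤ D * (a / 2) := by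
      have : D * (a / 2) - ((a * μ2 / 2 + N * a / 2) + a * (l ^ 2 / 2)) = τq * k / 2 := by
        rw [hD, hN]; field_simp; ring
      have : 0 < τq * k / 2 := by positivity
      linarith
    have h4 := mul_le_mul_of_nonneg_right h2 (nq t)
    have h5 := mul_le_mul_of_nonneg_right h3 (nT t)
    have h6 := mul_le_mul_of_nonneg_left hP ha.le
    rw [hE]
    simp only
    linarith
  -- dissipation
  have hdis : ∀ t, 0 < t → ∫ x in (0:ℝ)..l, et x t ≤ -β * E t := by
    intro t ht
    obtain ⟨Φ, hΦ⟩ : ∃ Φ : ℝ → ℝ, Φ = fun x => -μ2 * (qx x t * W x t) + k * (T x t * W x t)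
      - N * (T x t * q x t) + N * μ2 / k * (q x t * qx x t) := ⟨_, rfl⟩
    obtain ⟨Φ', hΦ'⟩ : ∃ Φ' : ℝ → ℝ, Φ' = fun x =>
      -μ2 * (qxx x t * W x t + qx x t * T x t) + k * (Tx x t * W x t + T x t * T x t)
      - N * (Tx x t * q x t + T x t * qx x t)
      + N * μ2 / k * (qx x t * qx x t + q x t * qxx x t) := ⟨_, rfl⟩
    have sT := gk_slice cT ht.le
    have sq' := gk_slice cq ht.le
    have sW := gk_slice cW ht.le
    have sTx := gk_slice cTx ht.le
    have sqx := gk_slice cqx ht.le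
    have sqxx := gk_slice cqxx ht.le
    have hΦc : ContinuousOn Φ (Icc 0 l) := by rw [hΦ]; fun_prop
    have hΦ'c : ContinuousOn Φ' (Icc 0 l) := by rw [hΦ']; fun_prop
    have hflux : ∫ x in (0:ℝ)..l, Φ' x = 0 := by
      rw [intervalIntegral.integral_eq_sub_of_hasDerivAt_of_le hl.le hΦc _ (gk_int hΦ'c hll)]
      · rw [hΦ]
        simp only [hW0, hWl t ht.le, bc0 t ht.le, bcl t ht.le]
        ring
      · intro x hx
        rw [hΦ, hΦ']
        have dT := hTx' x hx t ht
        have dq := hqx' x hx t ht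
        have dqx := hqxx' x hx t ht
        have dW := hWx x hx t ht
        exact ((((dqx.mul dW).const_mul (-μ2)).add ((dT.mul dW).const_mul k)).sub
          ((dT.mul dq).const_mul N)).add ((dq.mul dqx).const_mul (N * μ2 / k))
    have h1 : ∫ x in (0:ℝ)..l, et x t ≤ ∫ x in (0:ℝ)..l,
        (Φ' x + (-k * T x t ^ 2 + (τq / a - N / k) * q x t ^ 2)) := by
      apply intervalIntegral.integral_mono_on_of_le_Ioo hl.le (gk_int (gk_slice cet ht.le) hll)
        ((gk_int hΦ'c hll).add
          (((iT2 t ht.le).const_mul _).add ((iq2 t ht.le).const_mul _)))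
      intro x hx
      have p1 := pde1 x hx t ht
      have p2 := pde2 x hx t ht
      have p1' : Tt x t = -qx x t / a := by field_simp; linarith
      have p2' : qt x t = (-q x t + μ2 * qxx x t - k * Tx x t) / τq := by field_simp; linarith
      have h2 : et x t = Φ' x + (-k * T x t ^ 2 + (τq / a - N / k) * q x t ^ 2)
          - N * μ2 / k * qx x t ^ 2 := by
        rw [het, hΦ']
        simp only [p1', p2']
        field_simp
        ring
      have h3 : 0 ≤ N * μ2 / k * qx x t ^ 2 := by positivity
      linarith
    rw [intervalIntegral.integral_add (gk_int hΦ'c hll)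
      (((iT2 t ht.le).const_mul _).add ((iq2 t ht.le).const_mul _)), hflux,
      hcomb _ _ t ht.le] at h1
    have b1 : β * (a / 2) ≤ k := by
      have : β ≤ 2 * k / a := by rw [hβ]; exact min_le_left _ _
      calc β * (a / 2) ≤ 2 * k / a * (a / 2) := by gcongr
        _ = k := by field_simp
    have b2 : β * (τq / (2 * k)) ≤ N / k - τq / a := by
      have : β ≤ 4 * (l ^ 2 + μ2) / τq := by rw [hβ]; exact min_le_right _ _
      calc β * (τq / (2 * k)) ≤ 4 * (l ^ 2 + μ2) / τq * (τq / (2 * k)) := by gcongr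
        _ = N / k - τq / a := by rw [hN]; field_simp; ring
    have b3 := mul_le_mul_of_nonneg_right b1 (nT t)
    have b4 := mul_le_mul_of_nonneg_right b2 (nq t)
    rw [hE]
    simp only
    linarith
  have hβpos : 0 < β := by rw [hβ]; apply lt_min <;> positivity
  have hanti : AntitoneOn (fun t => L t * Real.exp (ω * t)) (Ici 0) := by
    have hder : ∀ t ∈ interior (Ici (0:ℝ)), HasDerivAt (fun t => L t * Real.exp (ω * t))
        ((∫ x in (0:ℝ)..l, et x t) * Real.exp (ω * t)
          + L t * (Real.exp (ω * t) * (ω * 1))) t := by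
      intro t ht
      rw [interior_Ici] at ht
      exact (hLd t ht).mul (((hasDerivAt_id t).const_mul ω).exp)
    apply antitoneOn_of_deriv_nonpos (convex_Ici 0)
    · exact hLc.mul (by fun_prop)
    · exact fun t ht => (hder t ht).differentiableAt.differentiableWithinAt
    · intro t ht
      rw [(hder t ht).deriv]
      rw [interior_Ici] at ht
      have ht0 : 0 < t := ht
      have h1 := hdis t ht0
      have h2 : ω * L t ≤ β * E t := by
        calc ω * L t ≤ ω * (D * E t) := by
              apply mul_le_mul_of_nonneg_left (hup t ht0.le)
              rw [hω]; positivity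
          _ = β * E t := by rw [hω]; field_simp
      have h3 : (∫ x in (0:ℝ)..l, et x t) + ω * L t ≤ 0 := by linarith
      have h4 := mul_nonpos_of_nonpos_of_nonneg h3 (Real.exp_pos (ω * t)).le
      linarith
  intro t ht
  have h1 := hanti (mem_Ici.mpr le_rfl) (mem_Ici.mpr ht) ht
  simp only [mul_zero, Real.exp_zero, mul_one] at h1
  have h2 := hup 0 le_rfl
  have h3 := hlow t ht
  have hS : 0 < l ^ 2 + μ2 := by positivity
  have h4 : L t ≤ D * E 0 * Real.exp (-ω * t) := by
    have h5 : L t = L t * Real.exp (ω * t) * Real.exp (-ω * t) := by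
      rw [mul_assoc, ← Real.exp_add]; simp
    rw [h5]
    exact mul_le_mul_of_nonneg_right (h1.trans h2) (Real.exp_pos _).le
  have h6 : E t ≤ M₀ * E 0 * Real.exp (-ω * t) := by
    have h7 : M₀ * E 0 * Real.exp (-ω * t) = (D * E 0 * Real.exp (-ω * t)) / (l ^ 2 + μ2) := by
      rw [hM₀]; ring
    rw [h7, le_div_iff₀ hS]
    linarith
  rw [hE] at h6
  exact h6
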